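/- Let $S_1, \ldots, S_r$ be finite non-abelian simple groups and let $N = S_1 \times \cdots \times S_r$ be their direct product. Then $P(N) = \sum_{i=1}^{r} P(S_i)$, where $P(X)$ denotes the minimal faithful permutation degree of the finite group $X$. -/

import Mathlib

/-- The minimal faithful permutation degree of a group `X`: the least `n` such that `X`
embeds in `Sym(n)`. -/
noncomputable def minFaithfulDegree (X : Type*) [Group X] : ℕ :=
  sInf {n : ℕ | ∃ f : X →* Equiv.Perm (Fin n), Function.Injective f}

section MinFaithfulDegree

variable {G : Type*} [Group G]

theorem minFaithfulDegree_le_card {α : Type*} [Finite α] (f : G →* Equiv.Perm α)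
    (hf : Function.Injective f) : minFaithfulDegree G ≤ Nat.card α :=
  Nat.sInf_le ⟨(Finite.equivFin α).permCongrHom.toMonoidHom.comp f,
    (Finite.equivFin α).permCongrHom.injective.comp hf⟩

theorem exists_injective_perm_minFaithfulDegree [Finite G] :
    ∃ f : G →* Equiv.Perm (Fin (minFaithfulDegree G)), Function.Injective f :=
  Nat.sInf_mem (s := {n : ℕ | ∃ f : G →* Equiv.Perm (Fin n), Function.Injective f})
    ⟨Nat.card G, (Finite.equivFin G).permCongrHom.toMonoidHom.comp (MulAction.toPermHom G G),
      (Finite.equivFin G).permCongrHom.injective.comp MulAction.toPerm_injective⟩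

theorem minFaithfulDegree_le_of_injective {G' : Type*} [Group G'] [Finite G'] (f : G →* G')
    (hf : Function.Injective f) : minFaithfulDegree G ≤ minFaithfulDegree G' := by
  obtain ⟨g, hg⟩ := exists_injective_perm_minFaithfulDegree (G := G')
  exact Nat.sInf_le ⟨g.comp f, hg.comp hf⟩

theorem two_le_minFaithfulDegree [Finite G] [Nontrivial G] : 2 ≤ minFaithfulDegree G := by
  by_contra! h
  obtain ⟨f, hf⟩ := exists_injective_perm_minFaithfulDegree (G := G)
  have : Subsingleton (Fin (minFaithfulDegree G)) := Fin.subsingleton_iff_le_one.2 (by omega)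
  exact not_subsingleton G hf.subsingleton

theorem minFaithfulDegree_le_index [Finite G] [IsSimpleGroup G] (H : Subgroup G) (hH : H ≠ ⊤) :
    minFaithfulDegree G ≤ H.index := by
  refine minFaithfulDegree_le_card (MulAction.toPermHom G (G ⧸ H)) ?_
  rw [← MonoidHom.ker_eq_bot_iff, ← Subgroup.normalCore_eq_ker]
  refine (Subgroup.normalCore_normal H).eq_bot_or_eq_top.resolve_right fun h => hH ?_
  exact top_le_iff.1 (h ▸ H.normalCore_le)

theorem two_mul_minFaithfulDegree_le_card [Finite G] [IsSimpleGroup G]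
    (hG : ¬ ∀ a b : G, a * b = b * a) : 2 * minFaithfulDegree G ≤ Nat.card G := by
  obtain ⟨g, hg⟩ := exists_ne (1 : G)
  have hne : Subgroup.zpowers g ≠ ⊤ := fun h => hG fun a b => by
    obtain ⟨m, rfl⟩ := Subgroup.mem_zpowers_iff.1 (h ▸ Subgroup.mem_top a)
    obtain ⟨n, rfl⟩ := Subgroup.mem_zpowers_iff.1 (h ▸ Subgroup.mem_top b)
    exact zpow_mul_comm g m n
  have h2 : 2 ≤ Nat.card (Subgroup.zpowers g) := by
    have := (Subgroup.one_lt_card_iff_ne_bot (Subgroup.zpowers g)).2 (by simpa using hg)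
    omega
  rw [← Subgroup.card_mul_index (Subgroup.zpowers g)]
  exact Nat.mul_le_mul h2 (minFaithfulDegree_le_index _ hne)

theorem minFaithfulDegree_le_relIndex [Finite G] (H N : Subgroup G) [IsSimpleGroup N]
    (h : ¬ N ≤ H) : minFaithfulDegree N ≤ H.relIndex N :=
  minFaithfulDegree_le_index _ (by rwa [Ne, Subgroup.subgroupOf_eq_top])

/-- If `N` and `M` commute and `N ≤ MH`, then `H ∩ N` is normal in `N`. -/
theorem subgroupOf_normal_of_le_sup (H N M : Subgroup G) [M.Normal]
    (hcomm : ∀ a ∈ N, ∀ b ∈ M, Commute a b) (hle : N ≤ M ⊔ H) : (H.subgroupOf N).Normal := by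
  refine ⟨fun ⟨h, hN⟩ hH ⟨n, hn⟩ => ?_⟩
  rw [Subgroup.mem_subgroupOf] at hH ⊢
  obtain ⟨b, hb, k, hk, e⟩ := Subgroup.mem_sup_of_normal_left.1 (hle (inv_mem hn))
  have hn' : n = k⁻¹ * b⁻¹ := by rw [← inv_inv n, ← e, mul_inv_rev]
  have : n * h * n⁻¹ = k⁻¹ * h * k := by
    rw [← e, hn', mul_assoc k⁻¹, ← (hcomm h hN _ (inv_mem hb)).eq]
    group
  change n * h * n⁻¹ ∈ H
  rw [this]
  exact mul_mem (mul_mem (inv_mem hk) hH) hk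

theorem relIndex_eq_card_of_le_sup (H N M : Subgroup G) [IsSimpleGroup N] [M.Normal]
    (hcomm : ∀ a ∈ N, ∀ b ∈ M, Commute a b) (hle : N ≤ M ⊔ H) (hN : ¬ N ≤ H) :
    H.relIndex N = Nat.card N := by
  have h := (subgroupOf_normal_of_le_sup H N M hcomm hle).eq_bot_or_eq_top.resolve_right
    (by rwa [Subgroup.subgroupOf_eq_top])
  rw [Subgroup.relIndex, h, Subgroup.index_bot]

theorem commutator_le_of_le_sup (H N M L : Subgroup G) [N.Normal] [M.Normal]
    (hNM : ∀ a ∈ N, ∀ b ∈ M, Commute a b) (hLN : ∀ a ∈ L, ∀ b ∈ N, Commute a b)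
    (hLM : ∀ a ∈ L, ∀ b ∈ M, Commute a b) (hN : L ≤ N ⊔ H) (hM : L ≤ M ⊔ H) :
    ⁅L, L⁆ ≤ H := by
  rw [Subgroup.commutator_le]
  intro a ha a' ha'
  obtain ⟨b, hb, h, hh, e⟩ := Subgroup.mem_sup_of_normal_left.1 (hM (inv_mem ha))
  obtain ⟨c, hc, k, hk, e'⟩ := Subgroup.mem_sup_of_normal_left.1 (hN (inv_mem ha'))
  have q : ∀ x y : G, x⁻¹ * y ∈ H ↔ (x : G ⧸ H) = y := fun x y => QuotientGroup.eq.symm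
  have e1 : ((a⁻¹ : G) : G ⧸ H) = b := by
    rw [← e]; exact (QuotientGroup.mk_mul_of_mem b hh)
  have e2 : ((a'⁻¹ : G) : G ⧸ H) = c := by
    rw [← e']; exact (QuotientGroup.mk_mul_of_mem c hk)
  have s : ∀ x y : G, ((x * y : G) : G ⧸ H) = x • (y : G ⧸ H) := fun _ _ => rfl
  have key : ((a'⁻¹ * a⁻¹ : G) : G ⧸ H) = ((a⁻¹ * a'⁻¹ : G) : G ⧸ H) := by
    calc ((a'⁻¹ * a⁻¹ : G) : G ⧸ H) = ((a'⁻¹ * b : G) : G ⧸ H) := by rw [s, e1, s]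
      _ = ((b * c : G) : G ⧸ H) := by rw [(hLM _ (inv_mem ha') b hb).eq, s, e2, s]
      _ = ((c * a⁻¹ : G) : G ⧸ H) := by rw [← (hNM c hc b hb).eq, s, ← e1, s]
      _ = ((a⁻¹ * a'⁻¹ : G) : G ⧸ H) := by rw [← (hLN _ (inv_mem ha) c hc).eq, s, ← e2, s]
  rw [commutatorElement_def]
  convert (q _ _).2 key using 1
  group

theorem commutator_eq_self_of_isSimpleGroup (N : Subgroup G) [IsSimpleGroup N]
    (hN : ¬ ∀ a b : N, a * b = b * a) : ⁅N, N⁆ = N := by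
  have h : commutator N = ⊤ := by
    refine (inferInstance : (commutator N).Normal).eq_bot_or_eq_top.resolve_left fun h => hN ?_
    intro a b
    rw [commutator_def, Subgroup.commutator_eq_bot_iff_le_centralizer] at h
    exact (Subgroup.mem_centralizer_iff.1 (h (Subgroup.mem_top b)) a (Subgroup.mem_top a))
  have := congrArg (Subgroup.map N.subtype) h
  rwa [commutator_def, Subgroup.map_commutator, ← MonoidHom.range_eq_map, N.range_subtype] at this

theorem relIndex_normal_sup_eq [Finite G] (H N : Subgroup G) [N.Normal] :
    H.relIndex (N ⊔ H) = H.relIndex N := by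
  have h1 := Subgroup.relIndex_mul_relIndex (N ⊓ H) H (N ⊔ H) inf_le_right le_sup_right
  have h2 := Subgroup.relIndex_mul_relIndex (N ⊓ H) N (N ⊔ H) inf_le_left le_sup_left
  rw [Subgroup.inf_relIndex_right] at h1
  rw [Subgroup.inf_relIndex_left, Subgroup.relIndex_sup_left, ← h1, mul_comm] at h2
  have h0 : N.relIndex H ≠ 0 := Subgroup.index_ne_zero_of_finite
  exact (Nat.eq_of_mul_eq_mul_left (Nat.pos_of_ne_zero h0) h2).symm

theorem add_le_mul_of_eq_zero_or_two_le {p s m n : ℕ} (hp : 2 ≤ p) (hs : s = 0 ∨ 2 ≤ s)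
    (hpm : p ≤ m) (hsn : s ≤ n) (hn : 0 < n) : p + s ≤ n * m := by
  rcases hs with rfl | hs
  · nlinarith
  · exact (by nlinarith : p + s ≤ s * p).trans (Nat.mul_le_mul hsn hpm)

theorem sum_minFaithfulDegree_le_index [Finite G] {ι : Type*} (N : ι → Subgroup G)
    [∀ i, (N i).Normal] [∀ i, IsSimpleGroup (N i)]
    (hnonab : ∀ i, ¬ ∀ a b : N i, a * b = b * a)
    (hcomm : ∀ i j, i ≠ j → ∀ a ∈ N i, ∀ b ∈ N j, Commute a b) (A : Finset ι) :
    ∀ H : Subgroup G, (∀ i ∈ A, ¬ N i ≤ H) → ∑ i ∈ A, minFaithfulDegree (N i) ≤ H.index := by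
  classical
  induction A using Finset.strongInduction with
  | H A ih =>
  intro H hA
  obtain rfl | hne := A.eq_empty_or_nonempty
  · simp
  have hsum : ∀ B : Finset ι, ∑ i ∈ B, minFaithfulDegree (N i) = 0 ∨
      2 ≤ ∑ i ∈ B, minFaithfulDegree (N i) := fun B => by
    obtain rfl | ⟨k, hk⟩ := B.eq_empty_or_nonempty
    · simp
    · exact .inr (two_le_minFaithfulDegree.trans
        (Finset.single_le_sum (f := fun i => minFaithfulDegree (N i)) (by simp) hk))
  obtain ⟨i, hi, hmin⟩ := A.exists_min_image (fun i => H.relIndex (N i)) hne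
  have hindex : H.index = (N i ⊔ H).index * H.relIndex (N i) := by
    rw [← relIndex_normal_sup_eq, mul_comm, Subgroup.relIndex_mul_index le_sup_right]
  have hpos : 0 < (N i ⊔ H).index := Nat.pos_of_ne_zero Subgroup.index_ne_zero_of_finite
  have hi2 : 2 ≤ minFaithfulDegree (N i) := two_le_minFaithfulDegree
  by_cases hj : ∀ j ∈ A.erase i, ¬ N j ≤ N i ⊔ H
  · rw [← Finset.add_sum_erase _ _ hi, hindex]
    exact add_le_mul_of_eq_zero_or_two_le hi2 (hsum _)
      (minFaithfulDegree_le_relIndex _ _ (hA i hi)) (ih _ (Finset.erase_ssubset hi) _ hj) hpos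
  push Not at hj
  obtain ⟨j, hjA, hji⟩ := hj
  obtain ⟨hne, hjA'⟩ := Finset.mem_erase.1 hjA
  have hle : N j ⊔ H ≤ N i ⊔ H := sup_le hji le_sup_right
  have hsup : N j ⊔ H = N i ⊔ H := by
    have hmul := Subgroup.relIndex_mul_relIndex H _ _ le_sup_right hle
    rw [relIndex_normal_sup_eq, relIndex_normal_sup_eq] at hmul
    have h1 : 0 < H.relIndex (N j) := Nat.pos_of_ne_zero Subgroup.index_ne_zero_of_finite
    have h2 : (N j ⊔ H).relIndex (N i ⊔ H) ≤ 1 := by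
      have := hmin j hjA'
      by_contra! h
      nlinarith
    have h3 : (N j ⊔ H).relIndex (N i ⊔ H) ≠ 0 := Subgroup.index_ne_zero_of_finite
    exact hle.antisymm (Subgroup.relIndex_eq_one.1 (by omega))
  have hij : N i ≤ N j ⊔ H := hsup ▸ le_sup_left
  have hcardi := relIndex_eq_card_of_le_sup H (N i) (N j) (hcomm i j hne.symm) hij (hA i hi)
  have hcardj := relIndex_eq_card_of_le_sup H (N j) (N i) (hcomm j i hne) hji (hA j hjA')
  have heq : H.relIndex (N j) = H.relIndex (N i) := by
    rw [← relIndex_normal_sup_eq, hsup, relIndex_normal_sup_eq]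
  have hdi := two_mul_minFaithfulDegree_le_card (hnonab i)
  have hdj := two_mul_minFaithfulDegree_le_card (hnonab j)
  rw [← Finset.add_sum_erase _ _ hi, ← Finset.add_sum_erase _ _ hjA, ← add_assoc, hindex]
  refine add_le_mul_of_eq_zero_or_two_le (by omega) (hsum _) (by omega)
    (ih _ ((Finset.erase_ssubset hjA).trans (Finset.erase_ssubset hi)) _ fun k hk hki => ?_) hpos
  obtain ⟨hkj, hk⟩ := Finset.mem_erase.1 hk
  obtain ⟨hki', hkA⟩ := Finset.mem_erase.1 hk
  refine hA k hkA ?_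
  rw [← commutator_eq_self_of_isSimpleGroup (N k) (hnonab k)]
  exact commutator_le_of_le_sup H (N i) (N j) (N k) (hcomm i j hne.symm) (hcomm k i hki')
    (hcomm k j hkj) hki (hsup ▸ hki)

theorem sum_minFaithfulDegree_le_card [Finite G] {ι : Type*} [Fintype ι] (N : ι → Subgroup G)
    [hN : ∀ i, (N i).Normal] [∀ i, IsSimpleGroup (N i)]
    (hnonab : ∀ i, ¬ ∀ a b : N i, a * b = b * a)
    (hcomm : ∀ i j, i ≠ j → ∀ a ∈ N i, ∀ b ∈ N j, Commute a b)
    (X : Type*) [Finite X] [MulAction G X] [FaithfulSMul G X] :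
    ∑ i, minFaithfulDegree (N i) ≤ Nat.card X := by
  classical
  have := Fintype.ofFinite X
  let Ω := MulAction.orbitRel.Quotient G X
  have hmoved : ∀ i, ∃ x : X, ¬ N i ≤ MulAction.stabilizer G x := fun i => by
    by_contra! h
    obtain ⟨g, hg⟩ := exists_ne (1 : N i)
    refine hg (Subtype.ext (FaithfulSMul.eq_of_smul_eq_smul (α := X) fun x => ?_))
    rw [MulAction.mem_stabilizer_iff.1 (h x g.2), OneMemClass.coe_one, one_smul]
  choose x hx using hmoved
  have hout : ∀ i, ¬ N i ≤ MulAction.stabilizer G (Quotient.out (Quotient.mk'' (x i) : Ω)) := by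
    intro i h
    obtain ⟨g, hg⟩ : x i ∈ MulAction.orbit G (Quotient.out (Quotient.mk'' (x i) : Ω)) :=
      MulAction.orbitRel_apply.1 (Quotient.exact (Quotient.out_eq (Quotient.mk'' (x i) : Ω)).symm)
    refine hx i fun a ha => ?_
    have h' := MulAction.mem_stabilizer_iff.1 (h ((hN i).conj_mem a ha g⁻¹))
    rw [MulAction.mem_stabilizer_iff, ← hg]
    simpa [mul_smul, inv_smul_eq_iff] using h'
  have hcard : Nat.card X = ∑ ω : Ω, (MulAction.stabilizer G ω.out).index := by
    rw [Nat.card_congr (MulAction.selfEquivSigmaOrbits G X), Nat.card_sigma]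
    exact Finset.sum_congr rfl fun ω _ => (MulAction.index_stabilizer G ω.out).symm
  rw [hcard, ← Finset.sum_fiberwise (s := Finset.univ) (g := fun i => (Quotient.mk'' (x i) : Ω))]
  refine Finset.sum_le_sum fun ω _ =>
    sum_minFaithfulDegree_le_index N hnonab hcomm _ _ fun i hi => ?_
  rw [← (Finset.mem_filter.1 hi).2]
  exact hout i

end MinFaithfulDegree

theorem minFaithfulDegree_pi_le_sum {ι : Type*} [Fintype ι] (S : ι → Type*) [∀ i, Group (S i)]
    [∀ i, Finite (S i)] :
    minFaithfulDegree (∀ i, S i) ≤ ∑ i, minFaithfulDegree (S i) := by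
  choose f hf using fun i => exists_injective_perm_minFaithfulDegree (G := S i)
  let F : (∀ i, S i) →* ∀ i, Equiv.Perm (Fin (minFaithfulDegree (S i))) :=
    MonoidHom.piMap f
  have hF : Function.Injective F := fun a b h => funext fun i => hf i (congrFun h i)
  have h := minFaithfulDegree_le_card ((Equiv.Perm.sigmaCongrRightHom _).comp F)
    (Equiv.Perm.sigmaCongrRightHom_injective.comp hF)
  simpa using h

/-- For a direct product `N = S₁ × ⋯ × S_r` of finite non-abelian simple groups,
`P(N) = ∑ᵢ P(Sᵢ)`. -/
theorem minFaithfulDegree_pi (r : ℕ) (S : Fin r → Type*) [∀ i, Group (S i)]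
    [∀ i, Finite (S i)] (hsimple : ∀ i, IsSimpleGroup (S i))
    (hnonab : ∀ i, ¬ ∀ a b : S i, a * b = b * a) :
    minFaithfulDegree (∀ i, S i) = ∑ i, minFaithfulDegree (S i) := by
  refine (minFaithfulDegree_pi_le_sum S).antisymm ?_
  let e : ∀ i, S i ≃* (MonoidHom.mulSingle S i).range := fun i =>
    MonoidHom.ofInjective (Pi.mulSingle_injective i)
  have (i : Fin r) : IsSimpleGroup (MonoidHom.mulSingle S i).range :=
    (e i).symm.isSimpleGroup
  have (i : Fin r) : (MonoidHom.mulSingle S i).range.Normal := by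
    refine ⟨?_⟩
    rintro _ ⟨a, rfl⟩ g
    refine ⟨g i * a * (g i)⁻¹, funext fun j => ?_⟩
    obtain rfl | hj := eq_or_ne j i <;> simp [*]
  obtain ⟨f, hf⟩ := exists_injective_perm_minFaithfulDegree (G := ∀ i, S i)
  let _ : MulAction (∀ i, S i) (Fin (minFaithfulDegree (∀ i, S i))) := MulAction.compHom _ f
  have : FaithfulSMul (∀ i, S i) (Fin (minFaithfulDegree (∀ i, S i))) :=
    ⟨fun h => hf (Equiv.ext h)⟩
  have h := sum_minFaithfulDegree_le_card (fun i => (MonoidHom.mulSingle S i).range)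
    (fun i h => hnonab i fun a b => (e i).injective (by rw [map_mul, map_mul, h]))
    (by
      rintro i j hij _ ⟨a, rfl⟩ _ ⟨b, rfl⟩
      exact Pi.mulSingle_commute hij a b)
    (Fin (minFaithfulDegree (∀ i, S i)))
  rw [Nat.card_fin] at h
  exact (Finset.sum_le_sum fun i _ =>
    minFaithfulDegree_le_of_injective (e i).toMonoidHom (e i).injective).trans h
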